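/- Fix a₁ < a₂ in ℕ. The set { Φ(A) : A ⊆ ℕ with {a₁, a₂} ⊆ A } ⊆ ℝ has Hausdorff dimension zero. -/

import Mathlib

/-- The Moran sum `Σ_{a ∈ F} 2^{-a²·s}` for a finite set `F ⊆ ℕ`. -/
noncomputable def moranSumSq (F : Finset ℕ) (s : ℝ) : ℝ :=
  ∑ a ∈ F, (2 : ℝ) ^ (-((a : ℝ) ^ 2) * s)

/-- `Φ(A) = sup{ s(F) : F ⊆ A finite, #F ≥ 2 }` (with `sup ∅ = 0`, which is Lean's
convention for `sSup` of the empty set of reals), where `s(F)` is the unique positive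
root of `Σ_{a∈F} 2^{-a²·s} = 1`; by Bowen's formula, `Φ(A)` is the Hausdorff dimension
of the limit set of the subsystem indexed by `A` of a similarity IFS on `ℝ` satisfying
the OSC with contraction ratios `2^{-a²}`. -/
noncomputable def phiSq (A : Set ℕ) : ℝ :=
  sSup {s : ℝ | 0 < s ∧ ∃ F : Finset ℕ, ↑F ⊆ A ∧ 2 ≤ F.card ∧ moranSumSq F s = 1}

open Set Filter Topology MeasureTheory

lemma continuous_moranSumSq (F : Finset ℕ) : Continuous (moranSumSq F) := by
  unfold moranSumSq
  refine continuous_finsetSum _ fun a _ ↦ ?_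
  exact Continuous.rpow continuous_const (by fun_prop) fun _ ↦ Or.inl (by norm_num)

lemma moranSumSq_mono {F G : Finset ℕ} (h : F ⊆ G) (s : ℝ) : moranSumSq F s ≤ moranSumSq G s :=
  Finset.sum_le_sum_of_subset_of_nonneg h fun _ _ _ ↦ by positivity

lemma two_rpow_neg_sq_mul_anti (a : ℕ) {s t : ℝ} (h : s ≤ t) :
    (2 : ℝ) ^ (-((a : ℝ) ^ 2) * t) ≤ 2 ^ (-((a : ℝ) ^ 2) * s) :=
  Real.rpow_le_rpow_of_exponent_le (by norm_num) (by nlinarith [sq_nonneg (a : ℝ)])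

lemma sum_half_pow_le_one {F : Finset ℕ} (hF : ∀ a ∈ F, 1 ≤ a) :
    ∑ a ∈ F, (1 / 2 : ℝ) ^ a ≤ 1 := by
  have h0 : 0 ∉ F := fun h ↦ by simpa using hF 0 h
  have h := summable_geometric_two.sum_le_tsum (insert 0 F) fun _ _ ↦ by positivity
  rw [Finset.sum_insert h0, tsum_geometric_two] at h
  norm_num at h ⊢
  linarith

lemma two_rpow_neg_sq_mul_le_half_pow {a : ℕ} (ha : 1 ≤ a) {s : ℝ} (hs : 1 ≤ s) :
    (2 : ℝ) ^ (-((a : ℝ) ^ 2) * s) ≤ (1 / 2 : ℝ) ^ a * 2 ^ (1 - s) := by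
  have h : (1 / 2 : ℝ) ^ a = 2 ^ (-(a : ℝ)) := by
    rw [Real.rpow_neg (by norm_num), Real.rpow_natCast]; simp
  rw [h, ← Real.rpow_add (by norm_num)]
  have ha' : (1 : ℝ) ≤ a := by exact_mod_cast ha
  exact Real.rpow_le_rpow_of_exponent_le (by norm_num)
    (by nlinarith [mul_nonneg (by nlinarith : (0 : ℝ) ≤ (a : ℝ) ^ 2 - 1) (sub_nonneg.2 hs)])

lemma moranSumSq_le_two_rpow {F : Finset ℕ} (hF : ∀ a ∈ F, 1 ≤ a) {s : ℝ} (hs : 1 ≤ s) :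
    moranSumSq F s ≤ 2 ^ (1 - s) := by
  calc moranSumSq F s ≤ ∑ a ∈ F, (1 / 2 : ℝ) ^ a * 2 ^ (1 - s) :=
        Finset.sum_le_sum fun a ha ↦ two_rpow_neg_sq_mul_le_half_pow (hF a ha) hs
    _ = (∑ a ∈ F, (1 / 2 : ℝ) ^ a) * 2 ^ (1 - s) := by rw [Finset.sum_mul]
    _ ≤ 1 * 2 ^ (1 - s) := by gcongr; exact sum_half_pow_le_one hF
    _ = _ := one_mul _

lemma le_one_of_moranSumSq_eq_one {F : Finset ℕ} (hF : ∀ a ∈ F, 1 ≤ a) {s : ℝ}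
    (hs : moranSumSq F s = 1) : s ≤ 1 := by
  by_contra! h
  have h1 := moranSumSq_le_two_rpow hF h.le
  have h2 : (2 : ℝ) ^ (1 - s) < 1 := Real.rpow_lt_one_of_one_lt_of_neg (by norm_num) (by linarith)
  linarith

lemma exists_moranSumSq_eq_one {F : Finset ℕ} (hF : ∀ a ∈ F, 1 ≤ a) {s₀ : ℝ} (hs₀ : s₀ ≤ 1)
    (h : 1 ≤ moranSumSq F s₀) : ∃ s, s₀ ≤ s ∧ s ≤ 1 ∧ moranSumSq F s = 1 := by
  have h1 : moranSumSq F 1 ≤ 1 := by simpa using moranSumSq_le_two_rpow hF le_rfl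
  obtain ⟨s, hs, hs'⟩ :=
    intermediate_value_Icc' hs₀ (continuous_moranSumSq F).continuousOn ⟨h1, h⟩
  exact ⟨s, hs.1, hs.2, hs'⟩

lemma le_phiSq {A : Set ℕ} (hA : ∀ a ∈ A, 1 ≤ a) {F : Finset ℕ} (hF : ↑F ⊆ A)
    (hc : 2 ≤ F.card) {s : ℝ} (hs0 : 0 < s) (hs : moranSumSq F s = 1) : s ≤ phiSq A := by
  refine le_csSup ⟨1, ?_⟩ ⟨hs0, F, hF, hc, hs⟩
  rintro t ⟨-, G, hG, -, ht⟩
  exact le_one_of_moranSumSq_eq_one (fun a ha ↦ hA a (hG ha)) ht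

lemma moranSumSq_le_of_forall_lt {s : ℝ} (hs : 0 < s) {n : ℕ} {F : Finset ℕ}
    (hF : ∀ a ∈ F, n < a) :
    moranSumSq F s ≤ (1 - (2 : ℝ) ^ (-s))⁻¹ * 2 ^ (-((n : ℝ) ^ 2) * s) := by
  have hq1 : (2 : ℝ) ^ (-s) < 1 := Real.rpow_lt_one_of_one_lt_of_neg (by norm_num) (by linarith)
  have hq0 : (0 : ℝ) ≤ 2 ^ (-s) := by positivity
  calc moranSumSq F s
      ≤ ∑ a ∈ F, ((2 : ℝ) ^ (-s)) ^ a * 2 ^ (-((n : ℝ) ^ 2) * s) := by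
        refine Finset.sum_le_sum fun a ha ↦ ?_
        rw [← Real.rpow_mul_natCast (by norm_num), ← Real.rpow_add (by norm_num)]
        have h : (n : ℝ) + 1 ≤ a := by exact_mod_cast hF a ha
        have hn : (0 : ℝ) ≤ n := n.cast_nonneg
        have h2 : (n : ℝ) ^ 2 + a ≤ (a : ℝ) ^ 2 := by nlinarith
        exact Real.rpow_le_rpow_of_exponent_le (by norm_num) (by nlinarith)
    _ = (∑ a ∈ F, ((2 : ℝ) ^ (-s)) ^ a) * 2 ^ (-((n : ℝ) ^ 2) * s) := by rw [Finset.sum_mul]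
    _ ≤ _ := by
        gcongr
        rw [← tsum_geometric_of_lt_one hq0 hq1]
        exact (summable_geometric_of_lt_one hq0 hq1).sum_le_tsum _ fun _ _ ↦ by positivity

lemma mul_sub_le_moranSumSq_sub {F : Finset ℕ} {a : ℕ} (haF : a ∈ F) (ha : 1 ≤ a) {s t : ℝ}
    (hst : s ≤ t) (ht : t ≤ 1) :
    (2 : ℝ) ^ (-((a : ℝ) ^ 2)) * Real.log 2 * (t - s) ≤ moranSumSq F s - moranSumSq F t := by
  have h1 : (2 : ℝ) ^ (-((a : ℝ) ^ 2) * s) - 2 ^ (-((a : ℝ) ^ 2) * t)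
      ≤ moranSumSq F s - moranSumSq F t := by
    unfold moranSumSq
    rw [← Finset.sum_sub_distrib]
    exact Finset.single_le_sum
      (f := fun a : ℕ ↦ (2 : ℝ) ^ (-((a : ℝ) ^ 2) * s) - 2 ^ (-((a : ℝ) ^ 2) * t))
      (fun b _ ↦ sub_nonneg.2 (two_rpow_neg_sq_mul_anti b hst)) haF
  refine le_trans ?_ h1
  have ha' : (1 : ℝ) ≤ (a : ℝ) ^ 2 := one_le_pow₀ (by exact_mod_cast ha)
  have hlog : 0 < Real.log 2 := Real.log_pos (by norm_num)
  have h2 : (2 : ℝ) ^ (-((a : ℝ) ^ 2) * s)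
      = 2 ^ (-((a : ℝ) ^ 2) * t) * 2 ^ ((a : ℝ) ^ 2 * (t - s)) := by
    rw [← Real.rpow_add (by norm_num)]; ring_nf
  have h3 : Real.log 2 * (t - s) ≤ (2 : ℝ) ^ ((a : ℝ) ^ 2 * (t - s)) - 1 := by
    have := Real.add_one_le_exp (Real.log 2 * ((a : ℝ) ^ 2 * (t - s)))
    rw [Real.rpow_def_of_pos (by norm_num)]
    nlinarith [mul_nonneg hlog.le (mul_nonneg (sub_nonneg.2 ha') (sub_nonneg.2 hst))]
  have h4 : (2 : ℝ) ^ (-((a : ℝ) ^ 2)) ≤ 2 ^ (-((a : ℝ) ^ 2) * t) := by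
    simpa using two_rpow_neg_sq_mul_anti a ht
  have h5 : 0 ≤ Real.log 2 * (t - s) := mul_nonneg hlog.le (sub_nonneg.2 hst)
  rw [h2, mul_assoc, ← mul_sub_one]
  exact mul_le_mul h4 h3 h5 (by positivity)

/-- The set function `phiSq` depends on the elements beyond `n` only up to an error of order
`2 ^ (-n² s₀)`. -/
lemma phiSq_le_phiSq_add {a₁ a₂ : ℕ} (ha : a₁ < a₂) {s₀ : ℝ} (hs₀ : 0 < s₀)
    (h : moranSumSq {a₁, a₂} s₀ = 1) {A B : Set ℕ} (hA : ∀ a ∈ A, 1 ≤ a) (hB : ∀ a ∈ B, 1 ≤ a)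
    (hB₁ : a₁ ∈ B) (hB₂ : a₂ ∈ B) {n : ℕ} (hAB : ∀ a ≤ n, a ∈ A → a ∈ B) :
    phiSq A ≤ phiSq B + ((2 : ℝ) ^ (-((a₁ : ℝ) ^ 2)) * Real.log 2)⁻¹ * (1 - (2 : ℝ) ^ (-s₀))⁻¹
      * 2 ^ (-((n : ℝ) ^ 2) * s₀) := by
  classical
  have hlog : 0 < Real.log 2 := Real.log_pos (by norm_num)
  have hq1 : (2 : ℝ) ^ (-s₀) < 1 := Real.rpow_lt_one_of_one_lt_of_neg (by norm_num) (by linarith)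
  have hq : 0 < (1 - (2 : ℝ) ^ (-s₀))⁻¹ := inv_pos.2 (by linarith)
  have h12 : ∀ a ∈ ({a₁, a₂} : Finset ℕ), 1 ≤ a := by
    intro a ha'
    simp only [Finset.mem_insert, Finset.mem_singleton] at ha'
    rcases ha' with rfl | rfl
    exacts [hB _ hB₁, hB _ hB₂]
  have hs₀1 : s₀ ≤ 1 := le_one_of_moranSumSq_eq_one h12 h
  have hφB : 0 ≤ phiSq B := hs₀.le.trans <| le_phiSq hB (F := {a₁, a₂})
    (by simp [Set.insert_subset_iff, hB₁, hB₂]) (by rw [Finset.card_pair ha.ne]) hs₀ h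
  refine Real.sSup_le ?_ (by positivity)
  rintro s ⟨-, F, hFA, -, hs⟩
  set F' : Finset ℕ := F.filter (· ≤ n) ∪ {a₁, a₂} with hF'
  have hF'B : (F' : Set ℕ) ⊆ B := by
    intro a ha'
    simp only [hF', Finset.mem_coe, Finset.mem_union, Finset.mem_filter, Finset.mem_insert,
      Finset.mem_singleton] at ha'
    rcases ha' with ⟨haF, han⟩ | rfl | rfl
    exacts [hAB a han (hFA haF), hB₁, hB₂]
  obtain ⟨s', hs₀s', -, hs'⟩ := exists_moranSumSq_eq_one (fun a ha ↦ hB a (hF'B ha)) hs₀1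
    (h ▸ moranSumSq_mono Finset.subset_union_right s₀)
  have hs'B : s' ≤ phiSq B := le_phiSq hB hF'B
    ((Finset.card_pair ha.ne).ge.trans (Finset.card_le_card Finset.subset_union_right))
    (hs₀.trans_le hs₀s') hs'
  rcases le_total s s' with hss | hss
  · have : 0 ≤ ((2 : ℝ) ^ (-((a₁ : ℝ) ^ 2)) * Real.log 2)⁻¹ * (1 - (2 : ℝ) ^ (-s₀))⁻¹
      * 2 ^ (-((n : ℝ) ^ 2) * s₀) := by positivity
    linarith
  have hs1 : s ≤ 1 := le_one_of_moranSumSq_eq_one (fun a ha ↦ hA a (hFA ha)) hs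
  have hlow := mul_sub_le_moranSumSq_sub (F := F') (a := a₁) (by simp [hF']) (hB _ hB₁) hss hs1
  have hsplit : moranSumSq F s
      = moranSumSq (F.filter (· ≤ n)) s + moranSumSq (F.filter (¬ · ≤ n)) s :=
    (Finset.sum_filter_add_sum_filter_not F (· ≤ n) _).symm
  have hhead : moranSumSq (F.filter (· ≤ n)) s ≤ moranSumSq F' s :=
    moranSumSq_mono Finset.subset_union_left s
  have htail : moranSumSq (F.filter (¬ · ≤ n)) s
      ≤ (1 - (2 : ℝ) ^ (-s₀))⁻¹ * 2 ^ (-((n : ℝ) ^ 2) * s₀) :=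
    (Finset.sum_le_sum fun a _ ↦ two_rpow_neg_sq_mul_anti a (hs₀s'.trans hss)).trans
      (moranSumSq_le_of_forall_lt hs₀ fun a ha' ↦ not_le.1 (Finset.mem_filter.1 ha').2)
  have key : (2 : ℝ) ^ (-((a₁ : ℝ) ^ 2)) * Real.log 2 * (s - s')
      ≤ (1 - (2 : ℝ) ^ (-s₀))⁻¹ * 2 ^ (-((n : ℝ) ^ 2) * s₀) := by linarith
  have key' := (le_inv_mul_iff₀ (by positivity)).2 key
  rw [mul_assoc]
  linarith

/-- A set covered at each stage `n` by `2 ^ (n + 1)` sets of diameter `O(2 ^ (-n² s₀))` has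
Hausdorff dimension zero. -/
lemma dimH_eq_zero_of_cover {X : Type*} [EMetricSpace X] {S : Set X} {C s₀ : ℝ}
    (hC : 0 ≤ C) (hs₀ : 0 < s₀) (t : ∀ n : ℕ, Finset (Fin (n + 1)) → Set X)
    (hdiam : ∀ n i, Metric.ediam (t n i) ≤ ENNReal.ofReal (C * 2 ^ (-((n : ℝ) ^ 2) * s₀)))
    (hcover : ∀ n, S ⊆ ⋃ i, t n i) : dimH S = 0 := by
  borelize X
  refine nonpos_iff_eq_zero.1 (ENNReal.le_of_forall_pos_le_add fun d hd _ ↦ ?_)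
  rw [zero_add]
  refine dimH_le_of_hausdorffMeasure_ne_top (ne_top_of_le_ne_top
    (ENNReal.ofReal_ne_top (r := C ^ (d : ℝ) * 2 ^ (1 + 1 / (4 * (s₀ * d))))) ?_)
  have hd' : (0 : ℝ) < d := hd
  have hr : Tendsto (fun n : ℕ ↦ ENNReal.ofReal (C * 2 ^ (-((n : ℝ) ^ 2) * s₀))) atTop (𝓝 0) := by
    rw [← ENNReal.ofReal_zero]
    refine ENNReal.tendsto_ofReal ?_
    rw [← mul_zero C]
    refine Tendsto.const_mul C ?_
    have h1 : Tendsto (fun n : ℕ ↦ -((n : ℝ) ^ 2) * s₀) atTop atBot :=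
      (tendsto_neg_atTop_atBot.comp
        ((tendsto_pow_atTop two_ne_zero).comp tendsto_natCast_atTop_atTop)).atBot_mul_const hs₀
    exact (tendsto_rpow_atBot_of_base_gt_one 2 (by norm_num)).comp h1
  refine (Measure.hausdorffMeasure_le_liminf_sum (d : ℝ) S _ hr t
    (Eventually.of_forall hdiam) (Eventually.of_forall hcover)).trans ?_
  refine liminf_le_of_frequently_le' (Eventually.of_forall fun n ↦ ?_).frequently
  calc ∑ i, Metric.ediam (t n i) ^ (d : ℝ)
      ≤ ∑ _i : Finset (Fin (n + 1)),
          ENNReal.ofReal (C * 2 ^ (-((n : ℝ) ^ 2) * s₀)) ^ (d : ℝ) := by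
        gcongr with i; exact hdiam n i
    _ = ENNReal.ofReal (2 ^ (n + 1) * (C * 2 ^ (-((n : ℝ) ^ 2) * s₀)) ^ (d : ℝ)) := by
        rw [ENNReal.ofReal_rpow_of_nonneg (by positivity) hd'.le, Finset.sum_const,
          Finset.card_univ, Fintype.card_finset, Fintype.card_fin, nsmul_eq_mul,
          ENNReal.ofReal_mul (by positivity)]
        congr 1
        rw [ENNReal.ofReal_pow (by norm_num)]
        simp
    _ ≤ _ := by
        refine ENNReal.ofReal_le_ofReal ?_
        rw [Real.mul_rpow hC (by positivity), mul_left_comm]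
        gcongr
        rw [← Real.rpow_mul (by norm_num), ← Real.rpow_natCast, ← Real.rpow_add (by norm_num)]
        refine Real.rpow_le_rpow_of_exponent_le (by norm_num) ?_
        have hc : 0 < s₀ * d := by positivity
        have hsq : 1 / (4 * (s₀ * d)) - n + (n : ℝ) ^ 2 * (s₀ * d)
            = (s₀ * d) * (n - 1 / (2 * (s₀ * d))) ^ 2 := by field_simp; ring
        have := mul_nonneg hc.le (sq_nonneg ((n : ℝ) - 1 / (2 * (s₀ * d))))
        push_cast
        linarith

/-- Fix `a₁ < a₂` in `ℕ = {1,2,...}`.  The set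
`{ Φ(A) : A ⊆ ℕ, {a₁, a₂} ⊆ A }` has Hausdorff dimension zero. -/
theorem dimH_phi_branch_zero (a₁ a₂ : ℕ) (ha₁ : 1 ≤ a₁) (ha : a₁ < a₂) :
    dimH {x : ℝ | ∃ A : Set ℕ, (∀ a ∈ A, 1 ≤ a) ∧ a₁ ∈ A ∧ a₂ ∈ A ∧ phiSq A = x} = 0 := by
  classical
  have hzero : moranSumSq {a₁, a₂} 0 = 2 := by
    simp [moranSumSq, Finset.card_pair ha.ne]
  obtain ⟨s₀, hs₀, -, hs⟩ := exists_moranSumSq_eq_one (F := {a₁, a₂}) (s₀ := 0)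
    (by simp only [Finset.mem_insert, Finset.mem_singleton]; omega) zero_le_one
    (by rw [hzero]; norm_num)
  have hs₀' : 0 < s₀ := hs₀.lt_of_ne fun h ↦ by rw [← h, hzero] at hs; norm_num at hs
  have hlog : 0 < Real.log 2 := Real.log_pos (by norm_num)
  have hq1 : (2 : ℝ) ^ (-s₀) < 1 := Real.rpow_lt_one_of_one_lt_of_neg (by norm_num) (by linarith)
  have hq : 0 < (1 - (2 : ℝ) ^ (-s₀))⁻¹ := inv_pos.2 (by linarith)
  refine dimH_eq_zero_of_cover
    (C := ((2 : ℝ) ^ (-((a₁ : ℝ) ^ 2)) * Real.log 2)⁻¹ * (1 - (2 : ℝ) ^ (-s₀))⁻¹)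
    (by positivity) hs₀'
    (fun n i ↦ {x : ℝ | ∃ A : Set ℕ, ((∀ a ∈ A, 1 ≤ a) ∧ a₁ ∈ A ∧ a₂ ∈ A ∧ phiSq A = x) ∧
      ∀ k : Fin (n + 1), k ∈ i ↔ (k : ℕ) ∈ A}) ?_ ?_
  · intro n i
    refine Metric.ediam_le ?_
    rintro _ ⟨A, ⟨hA, hA₁, hA₂, rfl⟩, hAi⟩ _ ⟨B, ⟨hB, hB₁, hB₂, rfl⟩, hBi⟩
    have hAB : ∀ a ≤ n, a ∈ A ↔ a ∈ B := fun a han ↦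
      (hAi ⟨a, Nat.lt_succ_of_le han⟩).symm.trans (hBi ⟨a, Nat.lt_succ_of_le han⟩)
    rw [edist_dist]
    refine ENNReal.ofReal_le_ofReal ?_
    have h1 := phiSq_le_phiSq_add ha hs₀' hs hA hB hB₁ hB₂ fun a han ↦ (hAB a han).1
    have h2 := phiSq_le_phiSq_add ha hs₀' hs hB hA hA₁ hA₂ fun a han ↦ (hAB a han).2
    rw [Real.dist_eq, abs_le]
    constructor <;> linarith
  · rintro n x ⟨A, hA⟩
    exact mem_iUnion.2 ⟨Finset.univ.filter fun k : Fin (n + 1) ↦ (k : ℕ) ∈ A, A, hA, by simp⟩
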